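/- arXiv:2511.12226 — 3 statements merged into one kernel-verified Lean document; each statement's English description precedes it below -/
import Mathlib

section
/- Let g₁ and g₂ be Riemannian metrics on 𝕋ⁿ, C = C_{g₁}(g₂), and let h ∈ ℝⁿ with h ≠ 0. Assume β_{g₂}(h) = C · β_{g₁}(h). Then every Mather measure μ of g₁ with rotation vector h is also a Mather measure of g₂ with rotation vector h, and g₂,ₓ(v,v) = C · g₁,ₓ(v,v) for every (x,v) in the support of μ. -/
open MeasureTheory Matrix

noncomputable section

/-- The flat `n`-torus `𝕋ⁿ = ℝⁿ/ℤⁿ`. -/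
abbrev Torus (n : ℕ) := Fin n → AddCircle (1 : ℝ)

/-- The canonical projection `ℝⁿ → 𝕋ⁿ`. -/
def Torus.proj {n : ℕ} (x : Fin n → ℝ) : Torus n := fun i => (x i : AddCircle (1 : ℝ))

/-- A Riemannian metric on the torus `𝕋ⁿ`: a smooth assignment `x ↦ g_x` of a positive
definite symmetric bilinear form `g_x` on the (trivialized) tangent space `ℝⁿ`. -/
structure TorusMetric (n : ℕ) where
  val : Torus n → (Fin n → ℝ) → (Fin n → ℝ) → ℝ
  symm : ∀ x v w, val x v w = val x w v
  add_left : ∀ x v₁ v₂ w, val x (v₁ + v₂) w = val x v₁ w + val x v₂ w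
  smul_left : ∀ x (c : ℝ) v w, val x (c • v) w = c * val x v w
  posdef : ∀ x v, v ≠ 0 → 0 < val x v v
  smooth : ∀ v w, ContDiff ℝ (⊤ : ℕ∞) (fun x : Fin n → ℝ => val (Torus.proj x) v w)
  cont : Continuous (fun p : Torus n × (Fin n → ℝ) × (Fin n → ℝ) => val p.1 p.2.1 p.2.2)

/-- `ℤⁿ`-periodicity of a function on `ℝⁿ` (i.e. it descends to the torus `𝕋ⁿ`). -/
def ZPeriodic {n : ℕ} {E : Type*} (F : (Fin n → ℝ) → E) : Prop :=
  ∀ (x : Fin n → ℝ) (k : Fin n → ℤ), F (x + fun i => (k i : ℝ)) = F x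

/-- A closed Borel probability measure on `𝕋ⁿ × ℝⁿ`: it has finite first moment and
`∫ df_x(v) dμ(x,v) = 0` for every `C¹` function `f` on the torus; such an `f` is
represented by its `ℤⁿ`-periodic lift `F : ℝⁿ → ℝ`, whose differential descends to a
function `DF` on the torus. -/
def IsClosedMeasure {n : ℕ} (μ : Measure (Torus n × (Fin n → ℝ))) : Prop :=
  IsProbabilityMeasure μ ∧
  Integrable (fun p : Torus n × (Fin n → ℝ) => ‖p.2‖) μ ∧
  ∀ (F : (Fin n → ℝ) → ℝ) (DF : Torus n → (Fin n → ℝ) →L[ℝ] ℝ),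
    ContDiff ℝ 1 F → ZPeriodic F →
    (∀ x : Fin n → ℝ, DF (Torus.proj x) = fderiv ℝ F x) →
    ∫ p : Torus n × (Fin n → ℝ), DF p.1 p.2 ∂μ = 0

/-- The rotation vector (Schwartzman asymptotic cycle) `ρ(μ) = ∫ v dμ(x,v) ∈ ℝⁿ`. -/
def rotationVector {n : ℕ} (μ : Measure (Torus n × (Fin n → ℝ))) : Fin n → ℝ :=
  ∫ p : Torus n × (Fin n → ℝ), p.2 ∂μ

/-- The kinetic-energy integrand `(x,v) ↦ g_x(v,v)` of a metric `g`. -/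
def energyIntegrand {n : ℕ} (g : TorusMetric n) (p : Torus n × (Fin n → ℝ)) : ℝ :=
  g.val p.1 p.2 p.2

/-- Mather's β-function of the metric `g`:
`β_g(h) = inf { (1/2)∫ g_x(v,v) dμ : μ closed, ρ(μ) = h }` (the infimum being over
measures of finite action, the others having infinite action). -/
def beta {n : ℕ} (g : TorusMetric n) (h : Fin n → ℝ) : ℝ :=
  sInf {r : ℝ | ∃ μ : Measure (Torus n × (Fin n → ℝ)),
    IsClosedMeasure μ ∧ rotationVector μ = h ∧
    Integrable (energyIntegrand g) μ ∧
    r = (1 / 2) * ∫ p, energyIntegrand g p ∂μ}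

/-- The normalization constant
`C_{g₁}(g₂) = max_x max { g₂ₓ(v,v) : g₁ₓ(v,v) = 1 }`. -/
def normConst {n : ℕ} (g₁ g₂ : TorusMetric n) : ℝ :=
  sSup {r : ℝ | ∃ (x : Torus n) (v : Fin n → ℝ), g₁.val x v v = 1 ∧ g₂.val x v v = r}

/-- A Mather (minimizing) measure of `g` with rotation vector `h`: a closed measure with
rotation vector `h` attaining the infimum defining `β_g(h)`. -/
def IsMatherMeasure {n : ℕ} (g : TorusMetric n) (h : Fin n → ℝ)
    (μ : Measure (Torus n × (Fin n → ℝ))) : Prop :=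
  IsClosedMeasure μ ∧ rotationVector μ = h ∧ Integrable (energyIntegrand g) μ ∧
  (1 / 2) * ∫ p, energyIntegrand g p ∂μ = beta g h

/-- The (topological) support of a measure. -/
def measureSupport {α : Type*} [TopologicalSpace α] {_ : MeasurableSpace α}
    (μ : Measure α) : Set α :=
  {p | ∀ U : Set α, IsOpen U → p ∈ U → μ U ≠ 0}

end

namespace TorusMetric

variable {n : ℕ}

theorem val_smul_smul (g : TorusMetric n) (x : Torus n) (c : ℝ) (v : Fin n → ℝ) :
    g.val x (c • v) (c • v) = c ^ 2 * g.val x v v := by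
  rw [g.smul_left, g.symm, g.smul_left]
  ring

theorem val_zero (g : TorusMetric n) (x : Torus n) : g.val x 0 0 = 0 := by
  simpa using g.val_smul_smul x 0 0

theorem val_self_nonneg (g : TorusMetric n) (x : Torus n) (v : Fin n → ℝ) :
    0 ≤ g.val x v v := by
  rcases eq_or_ne v 0 with rfl | hv
  · exact (g.val_zero x).ge
  · exact (g.posdef x v hv).le

theorem continuous_energyIntegrand (g : TorusMetric n) : Continuous (energyIntegrand g) :=
  g.cont.comp (continuous_fst.prodMk (continuous_snd.prodMk continuous_snd))

/-- The set of values whose supremum is `normConst g₁ g₂` is bounded above. -/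
theorem bddAbove_normConst (g₁ g₂ : TorusMetric n) :
    BddAbove {r : ℝ | ∃ (x : Torus n) (v : Fin n → ℝ),
      g₁.val x v v = 1 ∧ g₂.val x v v = r} := by
  have hK : IsCompact ((Set.univ : Set (Torus n)) ×ˢ Metric.sphere (0 : Fin n → ℝ) 1) :=
    isCompact_univ.prod (isCompact_sphere _ _)
  have hcont : ContinuousOn (fun p => energyIntegrand g₂ p / energyIntegrand g₁ p)
      ((Set.univ : Set (Torus n)) ×ˢ Metric.sphere (0 : Fin n → ℝ) 1) := by
    refine g₂.continuous_energyIntegrand.continuousOn.div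
      g₁.continuous_energyIntegrand.continuousOn fun p hp => ?_
    exact (g₁.posdef p.1 p.2 (ne_zero_of_mem_unit_sphere ⟨p.2, hp.2⟩)).ne'
  obtain ⟨M, hM⟩ := hK.bddAbove_image hcont
  refine ⟨M, ?_⟩
  rintro r ⟨x, v, hv, rfl⟩
  have hv0 : v ≠ 0 := by
    rintro rfl
    rw [g₁.val_zero] at hv
    exact zero_ne_one hv
  have hn : ‖v‖ ≠ 0 := norm_ne_zero_iff.mpr hv0
  have hmem : (x, ‖v‖⁻¹ • v) ∈
      (Set.univ : Set (Torus n)) ×ˢ Metric.sphere (0 : Fin n → ℝ) 1 :=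
    ⟨Set.mem_univ _, by simp [norm_smul, hn]⟩
  have hle := hM (Set.mem_image_of_mem _ hmem)
  simp only [energyIntegrand, val_smul_smul, hv] at hle
  rwa [mul_div_mul_left _ _ (pow_ne_zero 2 (inv_ne_zero hn)), div_one] at hle

theorem val_le_normConst_mul (g₁ g₂ : TorusMetric n) (x : Torus n) (v : Fin n → ℝ) :
    g₂.val x v v ≤ normConst g₁ g₂ * g₁.val x v v := by
  rcases eq_or_ne v 0 with rfl | hv
  · simp [val_zero]
  have hpos := g₁.posdef x v hv
  have hsq : (√(g₁.val x v v))⁻¹ ^ 2 = (g₁.val x v v)⁻¹ := by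
    rw [inv_pow, Real.sq_sqrt hpos.le]
  rw [← div_le_iff₀ hpos]
  refine le_csSup (bddAbove_normConst g₁ g₂) ⟨x, (√(g₁.val x v v))⁻¹ • v, ?_, ?_⟩
  · rw [val_smul_smul, hsq, inv_mul_cancel₀ hpos.ne']
  · rw [val_smul_smul, hsq, div_eq_inv_mul]

theorem beta_le (g : TorusMetric n) {h : Fin n → ℝ} {μ : Measure (Torus n × (Fin n → ℝ))}
    (hμ : IsClosedMeasure μ) (hrot : rotationVector μ = h)
    (hint : Integrable (energyIntegrand g) μ) :
    beta g h ≤ (1 / 2) * ∫ p, energyIntegrand g p ∂μ := by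
  refine csInf_le ⟨0, ?_⟩ ⟨μ, hμ, hrot, hint, rfl⟩
  rintro r ⟨ν, -, -, -, rfl⟩
  exact mul_nonneg (by norm_num) (integral_nonneg fun p => g.val_self_nonneg p.1 p.2)

end TorusMetric

/-- Functions that are continuous and agree almost everywhere agree on the support. -/
theorem eq_of_ae_eq_of_mem_measureSupport {α β : Type*} [TopologicalSpace α]
    [MeasurableSpace α] [TopologicalSpace β] [T2Space β] {μ : Measure α} {f g : α → β}
    (hf : Continuous f) (hg : Continuous g) (hfg : f =ᵐ[μ] g) {p : α}
    (hp : p ∈ measureSupport μ) : f p = g p := by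
  by_contra hne
  exact hp {q | f q ≠ g q} (isOpen_ne_fun hf hg) hne (ae_iff.mp hfg)

/-- If `β_{g₂}(h) = C_{g₁}(g₂) · β_{g₁}(h)` at some `h ≠ 0`, then every
Mather measure of `g₁` with rotation vector `h` is also a Mather measure of `g₂` with
rotation vector `h`, and `g₂ₓ(v,v) = C_{g₁}(g₂) · g₁ₓ(v,v)` on its support. -/
theorem matherMeasure_of_beta_eq {n : ℕ} (g₁ g₂ : TorusMetric n) (h : Fin n → ℝ)
    (hh : h ≠ 0) (heq : beta g₂ h = normConst g₁ g₂ * beta g₁ h)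
    (μ : Measure (Torus n × (Fin n → ℝ))) (hμ : IsMatherMeasure g₁ h μ) :
    IsMatherMeasure g₂ h μ ∧
      ∀ p ∈ measureSupport μ, g₂.val p.1 p.2 p.2 = normConst g₁ g₂ * g₁.val p.1 p.2 p.2 := by
  obtain ⟨hclosed, hrot, hint, hmin⟩ := hμ
  have hle : energyIntegrand g₂ ≤ fun p => normConst g₁ g₂ * energyIntegrand g₁ p :=
    fun p => TorusMetric.val_le_normConst_mul g₁ g₂ p.1 p.2
  have hintC := hint.const_mul (normConst g₁ g₂)
  have hint₂ : Integrable (energyIntegrand g₂) μ := by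
    refine hintC.mono' g₂.continuous_energyIntegrand.aestronglyMeasurable
      (Filter.Eventually.of_forall fun p => ?_)
    rw [energyIntegrand, Real.norm_of_nonneg (g₂.val_self_nonneg p.1 p.2)]
    exact hle p
  have hlower := g₂.beta_le hclosed hrot hint₂
  have hupper := integral_mono hint₂ hintC hle
  have htotal : ∫ p, normConst g₁ g₂ * energyIntegrand g₁ p ∂μ = 2 * beta g₂ h := by
    rw [integral_const_mul, heq, ← hmin]
    ring
  refine ⟨⟨hclosed, hrot, hint₂, by linarith⟩, fun p hp => ?_⟩
  have hae := (integral_eq_iff_of_ae_le hint₂ hintC (Filter.Eventually.of_forall hle)).mp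
    (by linarith)
  exact eq_of_ae_eq_of_mem_measureSupport g₂.continuous_energyIntegrand
    (continuous_const.mul g₁.continuous_energyIntegrand) hae hp
end

section
/- Let g₁ be a Riemannian metric on 𝕋ⁿ, let φ : 𝕋ⁿ → ℝ be a smooth positive function with m = max φ, and set g₂ = φ · g₁. Suppose there exists h ∈ ℝⁿ, h ≠ 0, such that β_{g₂}(h) = m · β_{g₁}(h) and such that every point x ∈ 𝕋ⁿ lies in π(supp μ) for some Mather measure μ of g₁ with rotation vector h. Then φ(x) = m for all x ∈ 𝕋ⁿ, i.e., g₂ = m · g₁. -/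
open MeasureTheory Matrix

noncomputable section

/-- The fibrewise rescaling `(x, v) ↦ (x, c v)` as a measurable equivalence. -/
def fiberScale {n : ℕ} (c : ℝ) (hc : c ≠ 0) :
    (Torus n × (Fin n → ℝ)) ≃ᵐ (Torus n × (Fin n → ℝ)) :=
  MeasurableEquiv.prodCongr (MeasurableEquiv.refl _) (MeasurableEquiv.smul₀ c hc)

theorem fiberScale_apply {n : ℕ} (c : ℝ) (hc : c ≠ 0) (p : Torus n × (Fin n → ℝ)) :
    fiberScale c hc p = (p.1, c • p.2) := rfl

/-- Remove the zero section, rescale the velocities by `c` and multiply the mass by `c⁻¹`. -/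
def slowDown {n : ℕ} (c : ℝ) (hc : c ≠ 0) (μ : Measure (Torus n × (Fin n → ℝ))) :
    Measure (Torus n × (Fin n → ℝ)) :=
  ENNReal.ofReal c⁻¹ • (μ.restrict {p | p.2 ≠ 0}).map (fiberScale c hc)

theorem integral_slowDown {n : ℕ} {E : Type*} [NormedAddCommGroup E] [NormedSpace ℝ E]
    {c : ℝ} (hc : 0 < c) (μ : Measure (Torus n × (Fin n → ℝ)))
    {f : Torus n × (Fin n → ℝ) → E} (hf : ∀ x, f (x, 0) = 0) :
    ∫ p, f p ∂(slowDown c hc.ne' μ) = c⁻¹ • ∫ p, f (p.1, c • p.2) ∂μ := by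
  rw [slowDown, integral_smul_measure, ENNReal.toReal_ofReal (inv_nonneg.2 hc.le),
    (fiberScale c hc.ne').measurableEmbedding.integral_map]
  congr 1
  apply setIntegral_eq_integral_of_forall_compl_eq_zero
  rintro ⟨x, v⟩ hv
  have : v = 0 := by simpa using hv
  simp [this, fiberScale_apply, hf]

theorem integrable_slowDown {n : ℕ} {E : Type*} [NormedAddCommGroup E]
    {c : ℝ} (hc : 0 < c) (μ : Measure (Torus n × (Fin n → ℝ)))
    {f : Torus n × (Fin n → ℝ) → E} (hf : Integrable (fun p => f (p.1, c • p.2)) μ) :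
    Integrable f (slowDown c hc.ne' μ) := by
  refine Integrable.smul_measure ?_ ENNReal.ofReal_ne_top
  rw [(fiberScale c hc.ne').measurableEmbedding.integrable_map_iff]
  exact hf.restrict

theorem measurableSet_velocity_ne_zero {n : ℕ} :
    MeasurableSet {p : Torus n × (Fin n → ℝ) | p.2 ≠ 0} :=
  (measurable_snd (measurableSet_singleton (0 : Fin n → ℝ))).compl

theorem isProbabilityMeasure_slowDown {n : ℕ} (μ : Measure (Torus n × (Fin n → ℝ)))
    [IsFiniteMeasure μ] (hc : 0 < μ.real {p | p.2 ≠ 0}) :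
    IsProbabilityMeasure (slowDown (μ.real {p | p.2 ≠ 0}) hc.ne' μ) := by
  constructor
  rw [slowDown, Measure.smul_apply, MeasurableEquiv.map_apply, Set.preimage_univ,
    Measure.restrict_apply_univ, smul_eq_mul, ENNReal.ofReal_inv_of_pos hc, measureReal_def,
    ENNReal.ofReal_toReal (measure_ne_top _ _)]
  exact ENNReal.inv_mul_cancel (ENNReal.toReal_pos_iff.1 hc).1.ne' (measure_ne_top _ _)

theorem TorusMetric.val_smul_smul_s5 {n : ℕ} (g : TorusMetric n) (x : Torus n) (c : ℝ)
    (v : Fin n → ℝ) : g.val x (c • v) (c • v) = c ^ 2 * g.val x v v := by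
  rw [g.smul_left, g.symm, g.smul_left]; ring

theorem TorusMetric.val_zero_zero {n : ℕ} (g : TorusMetric n) (x : Torus n) :
    g.val x 0 0 = 0 := by
  simpa using g.val_smul_smul_s5 x 0 0

theorem energyIntegrand_nonneg {n : ℕ} (g : TorusMetric n) (p : Torus n × (Fin n → ℝ)) :
    0 ≤ energyIntegrand g p := by
  by_cases hp : p.2 = 0
  · simp [energyIntegrand, hp, g.val_zero_zero]
  · exact (g.posdef p.1 p.2 hp).le

theorem beta_le {n : ℕ} (g : TorusMetric n) {h : Fin n → ℝ}
    {μ : Measure (Torus n × (Fin n → ℝ))} (hμ : IsClosedMeasure μ)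
    (hρ : rotationVector μ = h) (hi : Integrable (energyIntegrand g) μ) :
    beta g h ≤ (1 / 2) * ∫ p, energyIntegrand g p ∂μ := by
  refine csInf_le ⟨0, ?_⟩ ⟨μ, hμ, hρ, hi, rfl⟩
  rintro r ⟨ν, -, -, -, rfl⟩
  have : 0 ≤ ∫ p, energyIntegrand g p ∂ν := integral_nonneg (energyIntegrand_nonneg g)
  positivity

theorem isClosedMeasure_slowDown {n : ℕ} {μ : Measure (Torus n × (Fin n → ℝ))}
    (hμ : IsClosedMeasure μ) (hc : 0 < μ.real {p | p.2 ≠ 0}) :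
    IsClosedMeasure (slowDown (μ.real {p | p.2 ≠ 0}) hc.ne' μ) := by
  obtain ⟨hprob, hint, hclosed⟩ := hμ
  refine ⟨isProbabilityMeasure_slowDown μ hc, integrable_slowDown hc μ ?_, ?_⟩
  · simpa only [norm_smul] using hint.const_mul _
  · intro F DF hF hper hDF
    rw [integral_slowDown hc μ (fun x => map_zero (DF x))]
    simp only [map_smul, integral_smul, hclosed F DF hF hper hDF, smul_zero]

theorem rotationVector_slowDown {n : ℕ} {μ : Measure (Torus n × (Fin n → ℝ))} {c : ℝ}
    (hc : 0 < c) : rotationVector (slowDown c hc.ne' μ) = rotationVector μ := by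
  rw [rotationVector, integral_slowDown hc μ (fun _ => rfl)]
  simp only [integral_smul, smul_smul, inv_mul_cancel₀ hc.ne', one_smul, rotationVector]

/-- A Mather measure with nonzero rotation vector does not charge the zero section. -/
theorem IsMatherMeasure.ae_velocity_ne_zero {n : ℕ} {g : TorusMetric n} {h : Fin n → ℝ}
    (hh : h ≠ 0) {μ : Measure (Torus n × (Fin n → ℝ))} (hμ : IsMatherMeasure g h μ) :
    ∀ᵐ p ∂μ, p.2 ≠ 0 := by
  obtain ⟨hcl, hρ, hi, hβ⟩ := hμ
  have := hcl.1
  have hnot : ¬ ∀ᵐ p ∂μ, p.2 = 0 := fun h0 =>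
    hh (hρ ▸ integral_eq_zero_of_ae h0)
  have hc : 0 < μ.real {p | p.2 ≠ 0} := by
    refine lt_of_le_of_ne measureReal_nonneg fun h0 => hnot ?_
    rw [ae_iff]
    exact (measureReal_eq_zero_iff (measure_ne_top _ _)).1 h0.symm
  have henergy : (fun p : Torus n × (Fin n → ℝ) =>
      energyIntegrand g (p.1, μ.real {p | p.2 ≠ 0} • p.2)) =
      fun p => μ.real {p | p.2 ≠ 0} ^ 2 * energyIntegrand g p :=
    funext fun p => g.val_smul_smul_s5 p.1 _ p.2
  have hle := beta_le g (isClosedMeasure_slowDown hcl hc)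
    ((rotationVector_slowDown hc).trans hρ)
    (integrable_slowDown hc μ (by rw [henergy]; exact hi.const_mul _))
  rw [integral_slowDown hc μ (fun x => g.val_zero_zero x), henergy, integral_const_mul, ← hβ,
    smul_eq_mul] at hle
  have hpos : 0 < ∫ p, energyIntegrand g p ∂μ := by
    refine lt_of_le_of_ne (integral_nonneg (energyIntegrand_nonneg g)) fun h0 => hnot ?_
    filter_upwards [(integral_eq_zero_iff_of_nonneg (energyIntegrand_nonneg g) hi).1 h0.symm]
      with p hp
    by_contra hv
    exact (g.posdef p.1 p.2 hv).ne' hp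
  have hone : 1 ≤ μ.real {p | p.2 ≠ 0} := by
    generalize μ.real {p | p.2 ≠ 0} = c at hc hle
    have : c⁻¹ * (c ^ 2 * ∫ p, energyIntegrand g p ∂μ) = c * ∫ p, energyIntegrand g p ∂μ := by
      field_simp
    rw [this] at hle
    by_contra! hlt
    nlinarith
  exact (prob_compl_eq_zero_iff measurableSet_velocity_ne_zero).2 <|
    le_antisymm prob_le_one <| by
      rwa [measureReal_def, ← ENNReal.ofReal_le_iff_le_toReal (measure_ne_top _ _),
        ENNReal.ofReal_one] at hone

end

/-- Let `g₂ = φ · g₁` with `φ` smooth positive and `m = max φ`. If for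
some `h ≠ 0` one has `β_{g₂}(h) = m · β_{g₁}(h)` and every point of `𝕋ⁿ` lies in the
projected support of some Mather measure of `g₁` with rotation vector `h`, then `φ ≡ m`,
i.e. `g₂ = m · g₁`. -/
theorem conformal_rigidity_global {n : ℕ} (g₁ g₂ : TorusMetric n) (φ : Torus n → ℝ)
    (hφsmooth : ContDiff ℝ (⊤ : ℕ∞) (fun x : Fin n → ℝ => φ (Torus.proj x)))
    (hφpos : ∀ x, 0 < φ x) (m : ℝ)
    (hm_le : ∀ x, φ x ≤ m) (hm_attained : ∃ x, φ x = m)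
    (hconf : ∀ x v w, g₂.val x v w = φ x * g₁.val x v w)
    (h : Fin n → ℝ) (hh : h ≠ 0)
    (heq : beta g₂ h = m * beta g₁ h)
    (hcover : ∀ x : Torus n, ∃ μ : Measure (Torus n × (Fin n → ℝ)),
      IsMatherMeasure g₁ h μ ∧ x ∈ Prod.fst '' measureSupport μ) :
    (∀ x, φ x = m) ∧ ∀ x v w, g₂.val x v w = m * g₁.val x v w := by
  have hcont : Continuous φ := by
    have hφ : φ = fun x => g₂.val x h h / g₁.val x h h := by
      funext x
      rw [hconf, mul_div_cancel_right₀ _ (g₁.posdef x h hh).ne']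
    have hval (g : TorusMetric n) : Continuous fun x => g.val x h h :=
      g.cont.comp (by fun_prop : Continuous fun x : Torus n => (x, h, h))
    rw [hφ]
    exact (hval g₂).div (hval g₁) fun x => (g₁.posdef x h hh).ne'
  have hall : ∀ x, φ x = m := by
    intro x
    obtain ⟨μ, hμ, p, hp, rfl⟩ := hcover x
    refine le_antisymm (hm_le _) (not_lt.1 fun hlt => ?_)
    refine hp {q | φ q.1 < m} (isOpen_lt (hcont.comp continuous_fst) continuous_const) hlt ?_
    have hne := hμ.ae_velocity_ne_zero hh
    obtain ⟨hcl, hρ, hi, hβ⟩ := hμ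
    have henergy : energyIntegrand g₂ = fun q => φ q.1 * energyIntegrand g₁ q :=
      funext fun q => hconf q.1 q.2 q.2
    have hi₂ : Integrable (energyIntegrand g₂) μ := by
      rw [henergy]
      refine hi.bdd_mul (c := m)
        (hcont.measurable.comp measurable_fst).aestronglyMeasurable (.of_forall fun q => ?_)
      rw [Real.norm_of_nonneg (hφpos _).le]
      exact hm_le _
    have hle := beta_le g₂ hcl hρ hi₂
    have hdefect_nonneg : ∀ q, 0 ≤ m * energyIntegrand g₁ q - energyIntegrand g₂ q := fun q => by
      rw [henergy, ← sub_mul]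
      exact mul_nonneg (sub_nonneg.2 (hm_le _)) (energyIntegrand_nonneg g₁ q)
    have hdefect_int : ∫ q, (m * energyIntegrand g₁ q - energyIntegrand g₂ q) ∂μ = 0 := by
      refine le_antisymm ?_ (integral_nonneg hdefect_nonneg)
      rw [integral_sub (hi.const_mul m) hi₂, integral_const_mul]
      rw [heq, ← hβ] at hle
      linarith
    have hdefect := (integral_eq_zero_iff_of_nonneg hdefect_nonneg
      ((hi.const_mul m).sub hi₂)).1 hdefect_int
    have hmax : ∀ᵐ q ∂μ, ¬ φ q.1 < m := by
      filter_upwards [hne, hdefect] with q hq hd hlt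
      have hpos : 0 < energyIntegrand g₁ q := g₁.posdef q.1 q.2 hq
      simp only [henergy, Pi.zero_apply, ← sub_mul] at hd
      exact (mul_pos (sub_pos.2 hlt) hpos).ne' hd
    simpa [ae_iff] using hmax
  exact ⟨hall, fun x v w => by rw [hconf, hall]⟩
end

section
/- Let L be a Tonelli Lagrangian on 𝕋ⁿ, let V : 𝕋ⁿ → ℝ be a C² function with max V = 0, and let h ∈ ℝⁿ with h ≠ 0. Assume β_{L+V}(h) = β_L(h). Then every Mather measure μ of L with rotation vector h is also a Mather measure of L+V with rotation vector h, and V(x) = 0 for every x ∈ π(supp μ). -/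
open MeasureTheory

noncomputable section

/-- A Tonelli Lagrangian on `𝕋ⁿ`: a `C²` function `L : 𝕋ⁿ × ℝⁿ → ℝ` (read through the
projection `ℝⁿ → 𝕋ⁿ`), fiberwise strictly convex in `v` with positive definite second
fiber derivative, and uniformly superlinear in `v`. -/
structure TonelliLagrangian (n : ℕ) where
  val : Torus n × (Fin n → ℝ) → ℝ
  smooth : ContDiff ℝ 2 (fun p : (Fin n → ℝ) × (Fin n → ℝ) => val (Torus.proj p.1, p.2))
  strictconvex : ∀ (x : Torus n) (v w : Fin n → ℝ), w ≠ 0 →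
    0 < iteratedFDeriv ℝ 2 (fun u => val (x, u)) v ![w, w]
  superlinear : ∀ A : ℝ, ∃ C : ℝ, ∀ p : Torus n × (Fin n → ℝ), A * ‖p.2‖ + C ≤ val p
  cont : Continuous val

/-- Mather's β-function of a Lagrangian `L : 𝕋ⁿ × ℝⁿ → ℝ`:
`β_L(h) = inf { ∫ L dμ : μ closed, ρ(μ) = h }` (the infimum being over measures of
finite action, the others having infinite action). -/
def betaL {n : ℕ} (L : Torus n × (Fin n → ℝ) → ℝ) (h : Fin n → ℝ) : ℝ :=
  sInf {r : ℝ | ∃ μ : Measure (Torus n × (Fin n → ℝ)),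
    IsClosedMeasure μ ∧ rotationVector μ = h ∧ Integrable L μ ∧ r = ∫ p, L p ∂μ}

/-- A Mather (minimizing) measure of the Lagrangian `L` with rotation vector `h`. -/
def IsMatherMeasureL {n : ℕ} (L : Torus n × (Fin n → ℝ) → ℝ) (h : Fin n → ℝ)
    (μ : Measure (Torus n × (Fin n → ℝ))) : Prop :=
  IsClosedMeasure μ ∧ rotationVector μ = h ∧ Integrable L μ ∧ ∫ p, L p ∂μ = betaL L h

end

theorem Torus.isOpenQuotientMap_proj {n : ℕ} :
    IsOpenQuotientMap (Torus.proj : (Fin n → ℝ) → Torus n) :=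
  IsOpenQuotientMap.piMap fun _ => QuotientAddGroup.isOpenQuotientMap_mk

theorem continuous_of_continuous_comp_proj {n : ℕ} {E : Type*} [TopologicalSpace E]
    {V : Torus n → E} (hV : Continuous fun x : Fin n → ℝ => V (Torus.proj x)) :
    Continuous V :=
  Torus.isOpenQuotientMap_proj.isQuotientMap.continuous_iff.mpr hV

/-- The values of `∫ L dμ` over closed measures bound `betaL L h` from above as soon as `L`
is bounded below. -/
theorem betaL_le {n : ℕ} {L : Torus n × (Fin n → ℝ) → ℝ} {C : ℝ} (hC : ∀ p, C ≤ L p)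
    {h : Fin n → ℝ} {μ : Measure (Torus n × (Fin n → ℝ))} (hμ : IsClosedMeasure μ)
    (hρ : rotationVector μ = h) (hL : Integrable L μ) :
    betaL L h ≤ ∫ p, L p ∂μ := by
  refine csInf_le ⟨C, ?_⟩ ⟨μ, hμ, hρ, hL, rfl⟩
  rintro r ⟨ν, hν, -, hLν, rfl⟩
  have := hν.1
  calc C = ∫ _, C ∂ν := by simp
    _ ≤ ∫ p, L p ∂ν := integral_mono (integrable_const C) hLν hC

/-- A continuous function vanishing almost everywhere vanishes on the support. -/
theorem eq_zero_of_mem_measureSupport {α : Type*} [TopologicalSpace α] {_ : MeasurableSpace α}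
    {μ : Measure α} {f : α → ℝ} (hf : Continuous f) (h : f =ᵐ[μ] 0) {p : α}
    (hp : p ∈ measureSupport μ) : f p = 0 := by
  by_contra hne
  exact hp {q | f q ≠ 0} (isOpen_ne_fun hf continuous_const) hne (ae_iff.mp h)

/-- Let `L` be a Tonelli Lagrangian on `𝕋ⁿ` and `V` a `C²` potential
with `max V = 0`. If `β_{L+V}(h) = β_L(h)` at some `h ≠ 0`, then every Mather measure `μ`
of `L` with rotation vector `h` is also a Mather measure of `L+V` with rotation vector
`h`, and `V ≡ 0` on `π(supp μ)`. -/
theorem mane_rigidity_on_support {n : ℕ} (L : TonelliLagrangian n) (V : Torus n → ℝ)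
    (hVsmooth : ContDiff ℝ 2 (fun x : Fin n → ℝ => V (Torus.proj x)))
    (hVle : ∀ x, V x ≤ 0) (hV0 : ∃ x, V x = 0)
    (h : Fin n → ℝ) (hh : h ≠ 0)
    (heq : betaL (fun p => L.val p + V p.1) h = betaL L.val h)
    (μ : Measure (Torus n × (Fin n → ℝ))) (hμ : IsMatherMeasureL L.val h μ) :
    IsMatherMeasureL (fun p => L.val p + V p.1) h μ ∧
      ∀ x ∈ Prod.fst '' measureSupport μ, V x = 0 := by
  obtain ⟨hclosed, hρ, hLint, hLmin⟩ := hμ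
  have := hclosed.1
  have hVcont : Continuous V := continuous_of_continuous_comp_proj hVsmooth.continuous
  have hVfst : Continuous fun p : Torus n × (Fin n → ℝ) => V p.1 := hVcont.comp continuous_fst
  obtain ⟨m, hm⟩ : ∃ m, ∀ x, m ≤ V x := by
    obtain ⟨m, hm⟩ := (isCompact_range hVcont).bddBelow
    exact ⟨m, fun x => hm ⟨x, rfl⟩⟩
  have hVint : Integrable (fun p : Torus n × (Fin n → ℝ) => V p.1) μ := by
    refine Integrable.of_bound hVfst.aestronglyMeasurable (-m) (ae_of_all _ fun p => ?_)
    rw [Real.norm_eq_abs, abs_of_nonpos (hVle _)]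
    exact neg_le_neg (hm _)
  obtain ⟨C, hC⟩ := L.superlinear 0
  have hsum : Integrable (fun p => L.val p + V p.1) μ := hLint.add hVint
  have hle := betaL_le (C := C + m) (fun p => add_le_add (by simpa using hC p) (hm p.1))
    hclosed hρ hsum
  have hadd : ∫ p, (L.val p + V p.1) ∂μ = ∫ p, L.val p ∂μ + ∫ p, V p.1 ∂μ :=
    integral_add hLint hVint
  have hVnonpos : ∫ p, V p.1 ∂μ ≤ 0 := integral_nonpos fun p => hVle p.1
  have hVzero : ∫ p, V p.1 ∂μ = 0 := by linarith
  refine ⟨⟨hclosed, hρ, hsum, by linarith⟩, ?_⟩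
  rintro _ ⟨p, hp, rfl⟩
  have hneg : (fun p : Torus n × (Fin n → ℝ) => -V p.1) =ᵐ[μ] 0 :=
    (integral_eq_zero_iff_of_nonneg (fun p : Torus n × (Fin n → ℝ) => neg_nonneg.mpr (hVle p.1))
      hVint.fun_neg).mp
      (by rw [integral_neg, hVzero, neg_zero])
  exact neg_eq_zero.mp (eq_zero_of_mem_measureSupport hVfst.neg hneg hp)
end
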